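/- Let α and β be real numbers and let n ≥ 1 be an integer. Then Σ_{k=1}^{n} ((−β)^k/k!) · B̂_{n,k}(v_1, v_2, …, v_{n−k+1}) = (−αβ)^n, where the j-th argument is v_j = (−1)^{j−1}·α^j·β^{j−1}/j for j = 1, …, n−k+1 (i.e. the arguments are α, −α²β/2, α³β²/3, …, (−1)^{n−k}α^{n−k+1}β^{n−k}/(n−k+1)). -/

import Mathlib

/-- The partition set `Λ^k_n` as a finset: functions `ℕ → ℕ` supported on `{1, …, n-k+1}`
with `k_1 + ⋯ + k_{n-k+1} = k` and `1·k_1 + 2·k_2 + ⋯ + (n-k+1)·k_{n-k+1} = n`. -/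
def lambdaSet (n k : ℕ) : Finset (ℕ → ℕ) :=
  (Finset.piAntidiag (Finset.Icc 1 (n - k + 1)) k).filter
    (fun v => ∑ j ∈ Finset.Icc 1 (n - k + 1), j * v j = n)

/-- The partial exponential Bell polynomial
`B_{n,k}(u_1, …, u_{n-k+1}) = n! Σ_{Λ^k_n} Π_j (1/k_j!) (u_j/j!)^{k_j}`. -/
noncomputable def bellB (n k : ℕ) (u : ℕ → ℝ) : ℝ :=
  (Nat.factorial n : ℝ) * ∑ v ∈ lambdaSet n k, ∏ j ∈ Finset.Icc 1 (n - k + 1),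
    (1 / (Nat.factorial (v j) : ℝ)) * (u j / (Nat.factorial j : ℝ)) ^ (v j)

/-- The partial ordinary Bell polynomial
`B̂_{n,k}(u_1, …, u_{n-k+1}) = k! Σ_{Λ^k_n} Π_j u_j^{k_j}/k_j!`. -/
noncomputable def bellBhat (n k : ℕ) (u : ℕ → ℝ) : ℝ :=
  (Nat.factorial k : ℝ) * ∑ v ∈ lambdaSet n k, ∏ j ∈ Finset.Icc 1 (n - k + 1),
    (u j) ^ (v j) / (Nat.factorial (v j) : ℝ)

open scoped Classical in
/-- The multiplicity functions supported on `{1, …, N}` of the partitions of `m`. -/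
noncomputable def multiplicitySet (N m : ℕ) : Finset (ℕ → ℕ) :=
  (Finset.range (m + 1)).biUnion fun k =>
    (Finset.piAntidiag (Finset.Icc 1 N) k).filter (fun v => ∑ j ∈ Finset.Icc 1 N, j * v j = m)

/-- The inverse of the centralizer order of a permutation with `v j` cycles of length `j`. -/
noncomputable def cycleWeight (N : ℕ) (v : ℕ → ℕ) : ℝ :=
  ∏ j ∈ Finset.Icc 1 N, ((j : ℝ)⁻¹) ^ (v j) / (Nat.factorial (v j) : ℝ)

lemma mem_multiplicitySet {N m : ℕ} {v : ℕ → ℕ} :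
    v ∈ multiplicitySet N m ↔
      ∑ j ∈ Finset.Icc 1 N, j * v j = m ∧ ∀ j, v j ≠ 0 → j ∈ Finset.Icc 1 N := by
  simp only [multiplicitySet, Finset.mem_biUnion, Finset.mem_range, Finset.mem_filter,
    Finset.mem_piAntidiag]
  constructor
  · rintro ⟨k, -, ⟨-, h⟩, h'⟩
    exact ⟨h', h⟩
  · rintro ⟨h, h'⟩
    refine ⟨_, ?_, ⟨rfl, h'⟩, h⟩
    rw [Nat.lt_succ_iff, ← h]
    exact Finset.sum_le_sum fun j hj => Nat.le_mul_of_pos_left _ (Finset.mem_Icc.1 hj).1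

lemma sum_update_succ {N j : ℕ} (hj : j ∈ Finset.Icc 1 N) (v : ℕ → ℕ) :
    ∑ i ∈ Finset.Icc 1 N, i * Function.update v j (v j + 1) i =
      ∑ i ∈ Finset.Icc 1 N, i * v i + j := by
  rw [← Finset.add_sum_erase _ _ hj, ← Finset.add_sum_erase _ (fun i => i * v i) hj,
    Finset.sum_congr rfl (g := fun i => i * v i)]
  · simp; ring
  · intro i hi
    rw [Function.update_of_ne (Finset.ne_of_mem_erase hi)]

lemma cycleWeight_update_succ {N j : ℕ} (hj : j ∈ Finset.Icc 1 N) (v : ℕ → ℕ) :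
    (j : ℝ) * (v j + 1 : ℕ) * cycleWeight N (Function.update v j (v j + 1)) =
      cycleWeight N v := by
  have hj0 : (j : ℝ) ≠ 0 := by
    have := (Finset.mem_Icc.1 hj).1
    positivity
  unfold cycleWeight
  rw [← Finset.mul_prod_erase _ _ hj,
    ← Finset.mul_prod_erase _ (fun i : ℕ => ((i : ℝ)⁻¹) ^ (v i) / (Nat.factorial (v i) : ℝ)) hj,
    Finset.prod_congr rfl
      (g := fun i : ℕ => ((i : ℝ)⁻¹) ^ (v i) / (Nat.factorial (v i) : ℝ)), ← mul_assoc]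
  · congr 1
    have h1 : ((v j + 1 : ℕ) : ℝ) ≠ 0 := by positivity
    have h2 : ((v j).factorial : ℝ) ≠ 0 := by positivity
    rw [Function.update_self, Nat.factorial_succ, Nat.cast_mul, pow_succ]
    field_simp
  · intro i hi
    rw [Function.update_of_ne (Finset.ne_of_mem_erase hi)]

lemma sum_part_mul_cycleWeight {N m j : ℕ} (hj : j ∈ Finset.Icc 1 N) (hjm : j ≤ m) :
    ∑ v ∈ multiplicitySet N m, (j : ℝ) * (v j : ℝ) * cycleWeight N v =
      ∑ v ∈ multiplicitySet N (m - j), cycleWeight N v := by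
  symm
  refine Finset.sum_of_injOn (fun v => Function.update v j (v j + 1)) ?_ ?_ ?_ ?_
  · intro v _ w _ h
    funext i
    have hi := congrFun h i
    by_cases hij : i = j
    · subst hij
      simpa using hi
    · simpa [hij] using hi
  · intro v hv
    rw [Finset.mem_coe, mem_multiplicitySet] at hv ⊢
    refine ⟨by rw [sum_update_succ hj, hv.1]; omega, fun i hi => ?_⟩
    by_cases hij : i = j
    · exact hij ▸ hj
    · exact hv.2 i (by simpa [hij] using hi)
  · intro v hv hv'
    rw [mem_multiplicitySet] at hv
    suffices v j = 0 by simp [this]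
    by_contra h0
    have hupd : Function.update (Function.update v j (v j - 1)) j
        (Function.update v j (v j - 1) j + 1) = v := by
      simp [Nat.sub_add_cancel (Nat.pos_of_ne_zero h0)]
    refine hv' ⟨Function.update v j (v j - 1), ?_, hupd⟩
    rw [Finset.mem_coe, mem_multiplicitySet]
    constructor
    · have := sum_update_succ hj (Function.update v j (v j - 1))
      rw [hupd, hv.1] at this
      omega
    · intro i hi
      by_cases hij : i = j
      · exact hij ▸ hj
      · exact hv.2 i (by simpa [hij] using hi)
  · intro v _
    simpa using (cycleWeight_update_succ hj v).symm

lemma mul_sum_cycleWeight {N m : ℕ} (hm : m ≤ N) :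
    (m : ℝ) * ∑ v ∈ multiplicitySet N m, cycleWeight N v =
      ∑ j ∈ Finset.Icc 1 m, ∑ v ∈ multiplicitySet N (m - j), cycleWeight N v := by
  have hsub : Finset.Icc 1 m ⊆ Finset.Icc 1 N := Finset.Icc_subset_Icc_right hm
  calc (m : ℝ) * ∑ v ∈ multiplicitySet N m, cycleWeight N v
      = ∑ v ∈ multiplicitySet N m, ∑ j ∈ Finset.Icc 1 N,
          (j : ℝ) * (v j : ℝ) * cycleWeight N v := by
        rw [Finset.mul_sum]
        refine Finset.sum_congr rfl fun v hv => ?_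
        rw [← Finset.sum_mul, ← (mem_multiplicitySet.1 hv).1]
        push_cast
        rfl
    _ = ∑ j ∈ Finset.Icc 1 N, ∑ v ∈ multiplicitySet N m,
          (j : ℝ) * (v j : ℝ) * cycleWeight N v := Finset.sum_comm
    _ = ∑ j ∈ Finset.Icc 1 m, ∑ v ∈ multiplicitySet N m,
          (j : ℝ) * (v j : ℝ) * cycleWeight N v := by
        refine (Finset.sum_subset hsub fun j hj hj' => Finset.sum_eq_zero fun v hv => ?_).symm
        have hle : j * v j ≤ m := by
          rw [← (mem_multiplicitySet.1 hv).1]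
          exact Finset.single_le_sum (f := fun i => i * v i) (fun _ _ => Nat.zero_le _) hj
        have hlt : m < j := by
          simp only [Finset.mem_Icc] at hj hj'
          omega
        have : v j = 0 := by
          by_contra h0
          exact absurd (Nat.le_mul_of_pos_right j (Nat.pos_of_ne_zero h0)) (by omega)
        simp [this]
    _ = _ := Finset.sum_congr rfl fun j hj =>
        sum_part_mul_cycleWeight (hsub hj) (Finset.mem_Icc.1 hj).2

lemma sum_cycleWeight {N m : ℕ} (hm : m ≤ N) :
    ∑ v ∈ multiplicitySet N m, cycleWeight N v = 1 := by
  induction m using Nat.strong_induction_on with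
  | _ m ih =>
    rcases Nat.eq_zero_or_pos m with rfl | hpos
    · have : multiplicitySet N 0 = {0} := by
        ext v
        rw [mem_multiplicitySet, Finset.mem_singleton]
        constructor
        · rintro ⟨h, h'⟩
          funext j
          by_contra h0
          have hj := h' j h0
          have := Finset.sum_eq_zero_iff.1 h j hj
          have h1 := (Finset.mem_Icc.1 hj).1
          rcases Nat.mul_eq_zero.1 this with h2 | h2
          · omega
          · exact h0 h2
        · rintro rfl
          simp
      simp [this, cycleWeight]
    · have h := mul_sum_cycleWeight hm
      rw [Finset.sum_congr rfl (g := fun _ => (1 : ℝ)) fun j hj => ih _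
        (by have := (Finset.mem_Icc.1 hj).1; omega) (by omega)] at h
      have hm0 : (m : ℝ) ≠ 0 := by positivity
      exact mul_left_cancel₀ hm0 (by simpa using h)

lemma mem_lambdaSet {n k : ℕ} (hk : k ∈ Finset.Icc 1 n) {v : ℕ → ℕ} :
    v ∈ lambdaSet n k ↔ v ∈ multiplicitySet n n ∧ ∑ j ∈ Finset.Icc 1 n, v j = k := by
  rw [Finset.mem_Icc] at hk
  have hsub : Finset.Icc 1 (n - k + 1) ⊆ Finset.Icc 1 n :=
    Finset.Icc_subset_Icc_right (by omega)
  have extend (hv : ∀ j, v j ≠ 0 → j ∈ Finset.Icc 1 (n - k + 1)) :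
      ∑ j ∈ Finset.Icc 1 (n - k + 1), v j = ∑ j ∈ Finset.Icc 1 n, v j ∧
      ∑ j ∈ Finset.Icc 1 (n - k + 1), j * v j = ∑ j ∈ Finset.Icc 1 n, j * v j := by
    have h0 : ∀ j, j ∉ Finset.Icc 1 (n - k + 1) → v j = 0 := fun j hj => by
      by_contra h
      exact hj (hv j h)
    exact ⟨Finset.sum_subset hsub fun j _ hj => h0 j hj,
      Finset.sum_subset hsub fun j _ hj => by rw [h0 j hj, mul_zero]⟩
  simp only [lambdaSet, mem_multiplicitySet, Finset.mem_filter, Finset.mem_piAntidiag]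
  constructor
  · rintro ⟨⟨h1, h2⟩, h3⟩
    obtain ⟨e1, e2⟩ := extend h2
    exact ⟨⟨e2 ▸ h3, fun j hj => hsub (h2 j hj)⟩, e1 ▸ h1⟩
  · rintro ⟨⟨h1, h2⟩, h3⟩
    have h4 : ∀ j, v j ≠ 0 → j ∈ Finset.Icc 1 (n - k + 1) := by
      intro j hj
      have hjn := h2 j hj
      have hle : ∑ i ∈ (Finset.Icc 1 n).erase j, v i ≤
          ∑ i ∈ (Finset.Icc 1 n).erase j, i * v i :=
        Finset.sum_le_sum fun i hi =>
          Nat.le_mul_of_pos_left _ (Finset.mem_Icc.1 (Finset.mem_of_mem_erase hi)).1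
      rw [← Finset.add_sum_erase _ _ hjn] at h1 h3
      rw [Finset.mem_Icc] at hjn ⊢
      refine ⟨hjn.1, ?_⟩
      obtain ⟨a, ha⟩ := Nat.exists_eq_succ_of_ne_zero hj
      obtain ⟨b, rfl⟩ := Nat.exists_eq_add_of_le hjn.1
      rw [ha] at h1 h3
      have : (1 + b) * a.succ = a + 1 + b + b * a := by
        rw [Nat.succ_eq_add_one]; ring
      omega
    obtain ⟨e1, e2⟩ := extend h4
    exact ⟨⟨e1 ▸ h3, h4⟩, e2 ▸ h1⟩

lemma pow_mul_prod_eq_cycleWeight (α β : ℝ) {n k : ℕ} (hk : k ∈ Finset.Icc 1 n) {v : ℕ → ℕ}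
    (hv : v ∈ lambdaSet n k) :
    (-β) ^ k * ∏ j ∈ Finset.Icc 1 (n - k + 1),
      ((-1 : ℝ) ^ (j - 1) * α ^ j * β ^ (j - 1) / (j : ℝ)) ^ (v j) / (Nat.factorial (v j) : ℝ) =
    (-(α * β)) ^ n * cycleWeight n v := by
  rw [Finset.mem_Icc] at hk
  simp only [lambdaSet, Finset.mem_filter, Finset.mem_piAntidiag] at hv
  obtain ⟨⟨h1, h2⟩, h3⟩ := hv
  have hw : cycleWeight n v = ∏ j ∈ Finset.Icc 1 (n - k + 1),
      ((j : ℝ)⁻¹) ^ (v j) / (Nat.factorial (v j) : ℝ) := by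
    refine (Finset.prod_subset (Finset.Icc_subset_Icc_right (by omega)) fun j _ hj => ?_).symm
    have : v j = 0 := by
      by_contra h
      exact hj (h2 j h)
    simp [this]
  have hβ : (-β) ^ k = ∏ j ∈ Finset.Icc 1 (n - k + 1), (-β) ^ v j := by
    rw [Finset.prod_pow_eq_pow_sum, h1]
  have hαβ : (-(α * β)) ^ n = ∏ j ∈ Finset.Icc 1 (n - k + 1), (-(α * β)) ^ (j * v j) := by
    rw [Finset.prod_pow_eq_pow_sum, h3]
  rw [hw, hβ, hαβ, ← Finset.prod_mul_distrib, ← Finset.prod_mul_distrib]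
  refine Finset.prod_congr rfl fun j hj => ?_
  obtain ⟨i, rfl⟩ := Nat.exists_eq_add_of_le' (Finset.mem_Icc.1 hj).1
  rw [← mul_div_assoc, ← mul_div_assoc, pow_mul, ← mul_pow, ← mul_pow, Nat.add_sub_cancel]
  congr 2
  rw [show -(α * β) = (-1) * α * β by ring, mul_pow, mul_pow]
  ring

/-- For real `α, β` and `n ≥ 1`:
`Σ_{k=1}^{n} ((-β)^k/k!) B̂_{n,k}(α, -α²β/2, …, (-1)^{n-k}α^{n-k+1}β^{n-k}/(n-k+1))
  = (-αβ)^n`, where the `j`-th argument is `(-1)^{j-1}·α^j·β^{j-1}/j`. -/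
theorem bellBhat_identity (α β : ℝ) (n : ℕ) (hn : 1 ≤ n) :
    ∑ k ∈ Finset.Icc 1 n, ((-β) ^ k / (Nat.factorial k : ℝ)) *
      bellBhat n k (fun j => (-1 : ℝ) ^ (j - 1) * α ^ j * β ^ (j - 1) / (j : ℝ)) =
    (-(α * β)) ^ n := by
  have hk (k : ℕ) (hk : k ∈ Finset.Icc 1 n) : ((-β) ^ k / (Nat.factorial k : ℝ)) *
      bellBhat n k (fun j => (-1 : ℝ) ^ (j - 1) * α ^ j * β ^ (j - 1) / (j : ℝ)) =
      ∑ v ∈ multiplicitySet n n with ∑ j ∈ Finset.Icc 1 n, v j = k,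
        (-(α * β)) ^ n * cycleWeight n v := by
    have hset : {v ∈ multiplicitySet n n | ∑ j ∈ Finset.Icc 1 n, v j = k} = lambdaSet n k := by
      ext v
      rw [Finset.mem_filter, mem_lambdaSet hk]
    rw [hset, bellBhat, ← mul_assoc, div_mul_cancel₀ _ (by positivity), Finset.mul_sum]
    exact Finset.sum_congr rfl fun v hv => pow_mul_prod_eq_cycleWeight α β hk hv
  rw [Finset.sum_congr rfl hk, Finset.sum_fiberwise_of_maps_to, ← Finset.mul_sum,
    sum_cycleWeight le_rfl, mul_one]
  intro v hv
  obtain ⟨h1, -⟩ := mem_multiplicitySet.1 hv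
  rw [Finset.mem_Icc]
  constructor
  · rw [Nat.one_le_iff_ne_zero]
    intro h
    rw [Finset.sum_eq_zero fun j hj => by rw [Finset.sum_eq_zero_iff.1 h j hj, mul_zero]] at h1
    omega
  · calc ∑ j ∈ Finset.Icc 1 n, v j ≤ ∑ j ∈ Finset.Icc 1 n, j * v j :=
          Finset.sum_le_sum fun j hj => Nat.le_mul_of_pos_left _ (Finset.mem_Icc.1 hj).1
      _ = n := h1
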